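/- arXiv:1912.07554 — 3 statements merged into one kernel-verified Lean document; each statement's English description precedes it below -/
import Mathlib

section
/- Let d ≥ 1 and let L = {L_i}_{i=1}^{d²} be a measure basis for d×d complex matrices with all weights l_i = tr L_i strictly positive. For nonzero real t, let L^t be the collinear measure basis L^t_i := t·L_i + (1−t)·(l_i/d)·I. Then the principal Wigner basis of L^t satisfies: PW(L^t) = PW(L) if t > 0, and PW(L^t) = SPW(L) (the shifted principal Wigner basis of L) if t < 0. -/
open Matrix BigOperators
open scoped ComplexOrder Kronecker

/-- A measure basis: a linearly independent family of `d²` Hermitian `d×d` complex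
matrices summing to the identity, with nonnegative traces. -/
def IsMeasureBasis {d : ℕ} (L : Fin (d ^ 2) → Matrix (Fin d) (Fin d) ℂ) : Prop :=
  (∀ i, (L i).IsHermitian) ∧ LinearIndependent ℝ L ∧ (∑ i, L i) = 1 ∧ ∀ i, 0 ≤ ((L i).trace).re

/-- A Wigner basis: an orthogonal measure basis. -/
def IsWignerBasis {d : ℕ} (L : Fin (d ^ 2) → Matrix (Fin d) (Fin d) ℂ) : Prop :=
  IsMeasureBasis L ∧ ∀ i j, i ≠ j → (L i * L j).trace = 0

/-- The rescaled frame operator `S_L(X) = ∑ⱼ (tr(X Lⱼ)/lⱼ) Lⱼ`. -/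
noncomputable def rsFrameOp {n : Type*} [Fintype n] {m : Type*} [Fintype m] [DecidableEq m]
    (L : n → Matrix m m ℂ) (X : Matrix m m ℂ) : Matrix m m ℂ :=
  ∑ j, (((X * L j).trace) / ((L j).trace)) • L j

/-- A map on matrices that is ℝ-linear, Hermiticity-preserving, self-adjoint with respect to
the Hilbert–Schmidt inner product on Hermitian matrices, and positive. -/
def IsPosSelfAdjMap {m : Type*} [Fintype m]
    (T : Matrix m m ℂ → Matrix m m ℂ) : Prop :=
  IsLinearMap ℝ T ∧ (∀ X, X.IsHermitian → (T X).IsHermitian) ∧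
  (∀ X Y, X.IsHermitian → Y.IsHermitian → (T X * Y).trace = (X * T Y).trace) ∧
  (∀ X, X.IsHermitian → 0 ≤ ((X * T X).trace).re)

/-- `T` is the (unique) positive self-adjoint inverse square root of the rescaled frame
operator of `L`, i.e. `S_L ∘ T ∘ T = id` on Hermitian matrices; `PW(L) i = T (L i)`. -/
def IsInvSqrtOfFrameOp {n : Type*} [Fintype n] {m : Type*} [Fintype m] [DecidableEq m]
    (L : n → Matrix m m ℂ) (T : Matrix m m ℂ → Matrix m m ℂ) : Prop :=
  IsPosSelfAdjMap T ∧ ∀ X : Matrix m m ℂ, X.IsHermitian → rsFrameOp L (T (T X)) = X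

theorem pos_sqrt_unique_aux {V : Type*} [NormedAddCommGroup V] [InnerProductSpace ℝ V]
    [FiniteDimensional ℝ V] (A B : V →ₗ[ℝ] V) (hA : A.IsSymmetric) (hB : B.IsSymmetric)
    (hAp : ∀ x, 0 ≤ inner ℝ x (A x)) (hBp : ∀ x, 0 ≤ inner ℝ x (B x))
    (h : ∀ x, A (A x) = B (B x)) : A = B := by
  refine (hB.eigenvectorBasis rfl).toBasis.ext fun i => ?_
  simp only [OrthonormalBasis.coe_toBasis]
  have hv := hB.apply_eigenvectorBasis rfl i
  have hn := (hB.eigenvectorBasis rfl).orthonormal.1 i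
  generalize hB.eigenvectorBasis rfl i = v at *
  generalize hB.eigenvalues rfl i = l at *
  simp only [RCLike.ofReal_real_eq_id, id] at hv
  have hl : 0 ≤ l := by
    have := hBp v
    rw [hv, inner_smul_right, real_inner_self_eq_norm_sq, hn] at this
    simpa using this
  have hAA : A (A v) = (l * l) • v := by rw [h, hv, map_smul, hv, smul_smul]
  rw [hv]
  rcases hl.eq_or_lt with h0 | h0
  · subst h0
    have h1 : inner ℝ (A v) (A v) = 0 := by
      rw [hA v (A v), hAA]; simp
    rw [inner_self_eq_zero.1 h1, zero_smul]
  · have h1 := hAp (A v - l • v)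
    have h2 : A (A v - l • v) = (-l) • (A v - l • v) := by
      rw [map_sub, map_smul, hAA, mul_smul]; module
    rw [h2, inner_smul_right, real_inner_self_eq_norm_sq] at h1
    have h3 : ‖A v - l • v‖ ^ 2 = 0 := by nlinarith [sq_nonneg ‖A v - l • v‖]
    exact sub_eq_zero.1 (by simpa using h3)

theorem pos_sqrt_unique_core {V : Type*} [AddCommGroup V] [Module ℝ V]
    [FiniteDimensional ℝ V] (c : InnerProductSpace.Core ℝ V)
    (A B : V →ₗ[ℝ] V) (hA : ∀ x y, c.inner (A x) y = c.inner x (A y))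
    (hB : ∀ x y, c.inner (B x) y = c.inner x (B y))
    (hAp : ∀ x, 0 ≤ c.inner x (A x)) (hBp : ∀ x, 0 ≤ c.inner x (B x))
    (h : ∀ x, A (A x) = B (B x)) : A = B := by
  letI : NormedAddCommGroup V := c.toNormedAddCommGroup
  letI : InnerProductSpace ℝ V := InnerProductSpace.ofCore c.toCore
  exact pos_sqrt_unique_aux A B hA hB hAp hBp h

section helpers

variable {m : Type*} [Fintype m] [DecidableEq m]

/-- Traceless Hermitian matrices. -/
def tracelessHerm (m : Type*) [Fintype m] : Submodule ℝ (Matrix m m ℂ) where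
  carrier := {X | X.IsHermitian ∧ X.trace = 0}
  add_mem' := fun ha hb => ⟨ha.1.add hb.1, by rw [trace_add, ha.2, hb.2, add_zero]⟩
  zero_mem' := ⟨Matrix.isHermitian_zero, by simp⟩
  smul_mem' := fun c x hx => ⟨by
    have := hx.1
    simp only [Matrix.IsHermitian] at *
    rw [conjTranspose_smul, this]; simp, by rw [trace_smul, hx.2, smul_zero]⟩

theorem herm_smul {X : Matrix m m ℂ} (hX : X.IsHermitian) (c : ℝ) : (c • X).IsHermitian := by
  simp only [Matrix.IsHermitian] at *
  rw [conjTranspose_smul, hX]; simp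

theorem herm_trace_sq_nonneg {X : Matrix m m ℂ} (hX : X.IsHermitian) : 0 ≤ (X * X).trace.re := by
  have h := (Matrix.posSemidef_conjTranspose_mul_self X).trace_nonneg
  rw [hX.eq] at h
  exact (Complex.le_def.1 h).1

theorem herm_eq_zero {X : Matrix m m ℂ} (hX : X.IsHermitian) (h : (X * X).trace.re = 0) :
    X = 0 := by
  have h1 := (Matrix.posSemidef_conjTranspose_mul_self X).trace_nonneg
  have h2 := (Complex.le_def.1 h1).2
  rw [← Matrix.trace_conjTranspose_mul_self_eq_zero_iff]
  rw [hX.eq] at *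
  exact Complex.ext h h2.symm

theorem herm_trace_re {X : Matrix m m ℂ} (hX : X.IsHermitian) : X.trace = (X.trace.re : ℂ) := by
  have h : star X.trace = X.trace := by rw [← trace_conjTranspose, hX.eq]
  exact (Complex.conj_eq_iff_re.1 h).symm

/-- Hilbert–Schmidt inner product on traceless Hermitian matrices. -/
noncomputable def hsCore (m : Type*) [Fintype m] [DecidableEq m] :
    InnerProductSpace.Core ℝ (tracelessHerm m) where
  inner := fun X Y => ((X : Matrix m m ℂ) * (Y : Matrix m m ℂ)).trace.re
  conj_inner_symm := fun X Y => congrArg Complex.re (trace_mul_comm (Y : Matrix m m ℂ) (X : Matrix m m ℂ))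
  re_inner_nonneg := fun X => herm_trace_sq_nonneg X.2.1
  add_left := fun X Y Z => by simp [add_mul]
  smul_left := fun X Y r => by simp
  definite := fun X h => Subtype.ext (herm_eq_zero X.2.1 h)

theorem rsFrameOp_symm {n : Type*} [Fintype n] (L : n → Matrix m m ℂ) (X Y : Matrix m m ℂ) :
    (rsFrameOp L X * Y).trace = (X * rsFrameOp L Y).trace := by
  simp only [rsFrameOp, Finset.sum_mul, Finset.mul_sum, trace_sum, smul_mul_assoc,
    mul_smul_comm, trace_smul, smul_eq_mul]
  refine Finset.sum_congr rfl fun j _ => ?_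
  rw [trace_mul_comm (L j) Y]; ring

theorem rsFrameOp_sub {n : Type*} [Fintype n] (L : n → Matrix m m ℂ) (X Y : Matrix m m ℂ) :
    rsFrameOp L (X - Y) = rsFrameOp L X - rsFrameOp L Y := by
  simp only [rsFrameOp, sub_mul, trace_sub, sub_div, sub_smul, Finset.sum_sub_distrib]

theorem rsFrameOp_inj {n : Type*} [Fintype n] {L : n → Matrix m m ℂ}
    {T : Matrix m m ℂ → Matrix m m ℂ} (hT : IsInvSqrtOfFrameOp L T) {X Y : Matrix m m ℂ}
    (hX : X.IsHermitian) (hY : Y.IsHermitian) (h : rsFrameOp L X = rsFrameOp L Y) : X = Y := by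
  rw [← sub_eq_zero]
  apply herm_eq_zero (hX.sub hY)
  have h0 : rsFrameOp L (X - Y) = 0 := by rw [rsFrameOp_sub, h, sub_self]
  have := rsFrameOp_symm L (X - Y) (T (T (X - Y)))
  rw [hT.2 _ (hX.sub hY), h0, zero_mul] at this
  rw [← this]; simp

theorem invSqrt_one {n : Type*} [Fintype n] {L : n → Matrix m m ℂ}
    {T : Matrix m m ℂ → Matrix m m ℂ} (hT : IsInvSqrtOfFrameOp L T)
    (h1 : rsFrameOp L 1 = 1) : T 1 = 1 := by
  obtain ⟨hlin, hherm, hsym, hpos⟩ := hT.1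
  have I1 : (1 : Matrix m m ℂ).IsHermitian := Matrix.isHermitian_one
  have hTT : T (T 1) = 1 :=
    rsFrameOp_inj hT (hherm _ (hherm _ I1)) I1 (by rw [hT.2 _ I1, h1])
  have hY : (T 1 - 1).IsHermitian := (hherm _ I1).sub I1
  have hTY : T (T 1 - 1) = -(T 1 - 1) := by rw [hlin.map_sub, hTT]; abel
  have h := hpos _ hY
  rw [hTY, mul_neg, trace_neg, Complex.neg_re] at h
  exact sub_eq_zero.1 (herm_eq_zero hY (le_antisymm (by linarith) (herm_trace_sq_nonneg hY)))

theorem invSqrt_mem {n : Type*} [Fintype n] {L : n → Matrix m m ℂ}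
    {T : Matrix m m ℂ → Matrix m m ℂ} (hT : IsInvSqrtOfFrameOp L T)
    (h1 : T 1 = 1) {X : Matrix m m ℂ} (hX : X ∈ tracelessHerm m) : T X ∈ tracelessHerm m := by
  refine ⟨hT.1.2.1 _ hX.1, ?_⟩
  have := hT.1.2.2.1 X 1 hX.1 Matrix.isHermitian_one
  rw [h1, mul_one, mul_one, hX.2] at this
  exact this

/-- Restriction of an inverse square root to the traceless Hermitian matrices. -/
noncomputable def restr (T : Matrix m m ℂ → Matrix m m ℂ) (hl : IsLinearMap ℝ T)
    (h : ∀ X ∈ tracelessHerm m, T X ∈ tracelessHerm m) : tracelessHerm m →ₗ[ℝ] tracelessHerm m :=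
  (hl.mk' T).restrict h

end helpers

/-- for the collinear measure basis `Lᵗ`, the principal Wigner basis is
`PW(L)` when `t > 0` and the shifted principal Wigner basis `SPW(L)` when `t < 0`. -/
theorem collinear_principal_wigner {d : ℕ} [NeZero d]
    (L : Fin (d ^ 2) → Matrix (Fin d) (Fin d) ℂ)
    (hL : IsMeasureBasis L) (hpos : ∀ i, 0 < ((L i).trace).re)
    (t : ℝ) (ht : t ≠ 0)
    (Lt : Fin (d ^ 2) → Matrix (Fin d) (Fin d) ℂ)
    (hLt : ∀ i, Lt i = t • L i +
      (((1 - t) * ((L i).trace).re / (d : ℝ)) • (1 : Matrix (Fin d) (Fin d) ℂ)))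
    (T Tt : Matrix (Fin d) (Fin d) ℂ → Matrix (Fin d) (Fin d) ℂ)
    (hT : IsInvSqrtOfFrameOp L T) (hTt : IsInvSqrtOfFrameOp Lt Tt) :
    (0 < t → ∀ i, Tt (Lt i) = T (L i)) ∧
    (t < 0 → ∀ i, Tt (Lt i) = -(T (L i)) +
      ((2 * ((L i).trace).re / (d : ℝ)) • (1 : Matrix (Fin d) (Fin d) ℂ))) := by
  have hd : (d : ℝ) ≠ 0 := Nat.cast_ne_zero.2 (NeZero.ne d)
  have hdC : (d : ℂ) ≠ 0 := Nat.cast_ne_zero.2 (NeZero.ne d)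
  obtain ⟨hH, -, hsum, -⟩ := hL
  have htr : ∀ i, (L i).trace = ((L i).trace.re : ℂ) := fun i => herm_trace_re (hH i)
  have hne : ∀ i, (L i).trace ≠ 0 := fun i h => by
    have := hpos i; rw [h] at this; simp at this
  have htrt : ∀ i, (Lt i).trace = (L i).trace := fun i => by
    rw [hLt, trace_add, trace_smul, trace_smul, trace_one, htr i]
    simp only [Complex.ofReal_re, Complex.real_smul, Fintype.card_fin]
    push_cast
    field_simp
    ring
  have hsl : ∑ i, (L i).trace.re = d := by
    rw [← Complex.re_sum, ← trace_sum, hsum, trace_one]; simp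
  have hsumt : ∑ i, Lt i = 1 := by
    simp only [hLt, Finset.sum_add_distrib, ← Finset.smul_sum, hsum, ← Finset.sum_smul,
      ← Finset.sum_div, ← Finset.mul_sum, hsl]
    rw [mul_div_assoc, div_self hd, mul_one, ← add_smul]; simp
  have hS1 : rsFrameOp L 1 = 1 := by
    simp only [rsFrameOp, one_mul, div_self (hne _), one_smul, hsum]
  have hSt1 : rsFrameOp Lt 1 = 1 := by
    have hnet : ∀ i, (Lt i).trace ≠ 0 := fun i => by rw [htrt]; exact hne i
    simp only [rsFrameOp, one_mul, div_self (hnet _), one_smul, hsumt]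
  have hT1 := invSqrt_one hT hS1
  have hTt1 := invSqrt_one hTt hSt1
  have hSt : ∀ Y : Matrix (Fin d) (Fin d) ℂ, Y.trace = 0 →
      rsFrameOp Lt Y = (t ^ 2) • rsFrameOp L Y := fun Y hY => by
    have e1 : ∀ j, (Y * Lt j).trace = t * (Y * L j).trace := fun j => by
      rw [hLt, mul_add, trace_add, mul_smul_comm, mul_smul_comm, trace_smul, trace_smul, mul_one,
        hY]
      simp
    have e2 : ∑ j, (Y * L j).trace = 0 := by
      rw [← trace_sum, ← Finset.mul_sum, hsum, mul_one, hY]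
    have e3 : ∀ j, ((Y * Lt j).trace / (Lt j).trace) • Lt j =
        (t ^ 2) • (((Y * L j).trace / (L j).trace) • L j) +
        ((t * (1 - t) / d : ℂ) * (Y * L j).trace) • (1 : Matrix (Fin d) (Fin d) ℂ) := fun j => by
      rw [e1, htrt, hLt]
      have hj := hne j
      have hc := htr j
      have hr : ∀ (r : ℝ) (M : Matrix (Fin d) (Fin d) ℂ), r • M = (r : ℂ) • M := fun r M => by
        ext a b; simp
      rw [hr, hr, hr, smul_add, smul_smul, smul_smul, smul_smul]
      congr 2
      · push_cast; ring
      · push_cast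
        rw [← hc]
        field_simp
    simp only [rsFrameOp]
    rw [Finset.sum_congr rfl fun j _ => e3 j, Finset.sum_add_distrib, ← Finset.sum_smul,
      ← Finset.mul_sum, e2, ← Finset.smul_sum]
    simp
  obtain ⟨hlin, hherm, hsym, hps⟩ := hT.1
  obtain ⟨hlint, hhermt, hsymt, hpst⟩ := hTt.1
  have hm : ∀ X ∈ tracelessHerm (Fin d), T X ∈ tracelessHerm (Fin d) :=
    fun X hX => invSqrt_mem hT hT1 hX
  have hmt : ∀ X ∈ tracelessHerm (Fin d), Tt X ∈ tracelessHerm (Fin d) :=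
    fun X hX => invSqrt_mem hTt hTt1 hX
  have hsq : ∀ X ∈ tracelessHerm (Fin d), T (T X) = (t ^ 2) • Tt (Tt X) := fun X hX => by
    have hY := hm _ (hm _ hX)
    have h2 : rsFrameOp Lt (T (T X)) = (t ^ 2) • X := by rw [hSt _ hY.2, hT.2 _ hX.1]
    have hX2 := (tracelessHerm (Fin d)).smul_mem (t ^ 2) hX
    have h3 : rsFrameOp Lt (Tt (Tt ((t ^ 2) • X))) = (t ^ 2) • X := hTt.2 _ hX2.1
    rw [← hlint.map_smul, ← hlint.map_smul]
    exact rsFrameOp_inj hTt hY.1 (hmt _ (hmt _ hX2)).1 (h2.trans h3.symm)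
  have key : restr T hlin hm = |t| • restr Tt hlint hmt := by
    refine pos_sqrt_unique_core (hsCore (Fin d)) _ _ ?_ ?_ ?_ ?_ ?_
    · intro X Y
      exact congrArg Complex.re (hsym X Y X.2.1 Y.2.1)
    · intro X Y
      have := congrArg Complex.re (hsymt X Y X.2.1 Y.2.1)
      change ((|t| • Tt X) * (Y : Matrix (Fin d) (Fin d) ℂ)).trace.re =
        ((X : Matrix (Fin d) (Fin d) ℂ) * (|t| • Tt Y)).trace.re
      rw [smul_mul_assoc, mul_smul_comm, trace_smul, trace_smul, Complex.smul_re,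
        Complex.smul_re, this]
    · intro X
      exact hps X X.2.1
    · intro X
      change 0 ≤ ((X : Matrix (Fin d) (Fin d) ℂ) * (|t| • Tt X)).trace.re
      rw [mul_smul_comm, trace_smul, Complex.smul_re]
      exact mul_nonneg (abs_nonneg t) (hpst X X.2.1)
    · intro X
      apply Subtype.ext
      change T (T X) = |t| • Tt (|t| • Tt X)
      rw [hsq X X.2, hlint.map_smul, smul_smul, abs_mul_abs_self, sq]
  have key' : ∀ X ∈ tracelessHerm (Fin d), T X = |t| • Tt X := fun X hX =>
    congrArg Subtype.val (LinearMap.congr_fun key ⟨X, hX⟩)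
  have hX0 : ∀ i, L i - ((L i).trace.re / (d : ℝ)) • (1 : Matrix (Fin d) (Fin d) ℂ)
      ∈ tracelessHerm (Fin d) := fun i => by
    refine ⟨(hH i).sub (herm_smul Matrix.isHermitian_one _), ?_⟩
    rw [trace_sub, trace_smul, trace_one, htr i]
    simp only [Complex.ofReal_re, Complex.real_smul, Fintype.card_fin]
    push_cast
    field_simp
    ring
  have hTL : ∀ i, T (L i) = |t| • Tt (L i - ((L i).trace.re / (d : ℝ)) • 1) +
      ((L i).trace.re / (d : ℝ)) • (1 : Matrix (Fin d) (Fin d) ℂ) := fun i => by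
    rw [← key' _ (hX0 i), hlin.map_sub, hlin.map_smul, hT1, sub_add_cancel]
  have hTL2 : ∀ i, Tt (Lt i) = t • Tt (L i - ((L i).trace.re / (d : ℝ)) • 1) +
      ((L i).trace.re / (d : ℝ)) • (1 : Matrix (Fin d) (Fin d) ℂ) := fun i => by
    have : Lt i = t • (L i - ((L i).trace.re / (d : ℝ)) • 1) +
      ((L i).trace.re / (d : ℝ)) • (1 : Matrix (Fin d) (Fin d) ℂ) := by
      rw [hLt]; module
    rw [this, hlint.map_add, hlint.map_smul, hlint.map_smul _ 1, hTt1]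
  refine ⟨fun h i => ?_, fun h i => ?_⟩
  · rw [hTL, hTL2, abs_of_pos h]
  · rw [hTL, hTL2, abs_of_neg h]; module
end

section
/- Let d ≥ 1, let F = {F_i}_{i=1}^{d²} be a Wigner basis for d×d complex matrices with all weights f_i = tr F_i strictly positive, and let L = {L_i}_{i=1}^{d²} be a measure basis with all weights strictly positive. Let R be the unique positive self-adjoint (with respect to the Hilbert–Schmidt inner product) linear map on Hermitian matrices with R∘R = S_L, where S_L is the rescaled frame operator of L. Then the family M_i := R(F_i) is a measure basis with tr M_i = f_i for all i, its rescaled frame operator equals S_L, and its principal Wigner basis is F: PW(M) = F. -/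
open Matrix BigOperators
open scoped ComplexOrder Kronecker

lemma pw_real_trace {d : ℕ} {X Y : Matrix (Fin d) (Fin d) ℂ} (hX : X.IsHermitian)
    (hY : Y.IsHermitian) : (X * Y).trace = (((X * Y).trace).re : ℂ) := by
  have h : star ((X * Y).trace) = (X * Y).trace := by
    rw [← Matrix.trace_conjTranspose, Matrix.conjTranspose_mul, hX.eq, hY.eq, Matrix.trace_mul_comm]
  exact (Complex.conj_eq_iff_re.mp h).symm

lemma pw_linInd_complex {d : ℕ} {F : Fin (d ^ 2) → Matrix (Fin d) (Fin d) ℂ}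
    (hH : ∀ i, (F i).IsHermitian) (hli : LinearIndependent ℝ F) : LinearIndependent ℂ F := by
  rw [Fintype.linearIndependent_iff] at hli ⊢
  intro c hc
  have hc' : ∑ i, star (c i) • F i = 0 := by
    have := congrArg Matrix.conjTranspose hc
    simpa [Matrix.conjTranspose_sum, Matrix.conjTranspose_smul, (hH _).eq] using this
  have h1 : ∑ i, (c i).re • F i = 0 := by
    have h2 : (2 : ℂ) • ∑ i, (c i).re • F i = ∑ i, c i • F i + ∑ i, star (c i) • F i := by
      rw [Finset.smul_sum, ← Finset.sum_add_distrib]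
      refine Finset.sum_congr rfl fun i _ => ?_
      rw [← add_smul, ← Complex.coe_smul, smul_smul]
      congr 1
      apply Complex.ext <;> simp
      ring
    rw [hc, hc', add_zero] at h2
    exact (smul_eq_zero.mp h2).resolve_left two_ne_zero
  have h3 : ∑ i, (c i).im • F i = 0 := by
    have h2 : (2 * Complex.I) • ∑ i, (c i).im • F i
        = ∑ i, c i • F i - ∑ i, star (c i) • F i := by
      rw [Finset.smul_sum, ← Finset.sum_sub_distrib]
      refine Finset.sum_congr rfl fun i _ => ?_
      rw [← sub_smul, ← Complex.coe_smul, smul_smul]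
      congr 1
      apply Complex.ext <;> simp
      ring
    rw [hc, hc', sub_zero] at h2
    exact (smul_eq_zero.mp h2).resolve_left (by simp)
  intro i
  exact Complex.ext (hli _ h1 i) (hli _ h3 i)

lemma pw_expand {d : ℕ} {F : Fin (d ^ 2) → Matrix (Fin d) (Fin d) ℂ}
    (hH : ∀ i, (F i).IsHermitian) (hli : LinearIndependent ℝ F)
    (X : Matrix (Fin d) (Fin d) ℂ) : ∃ c : Fin (d ^ 2) → ℂ, X = ∑ i, c i • F i := by
  have hC := pw_linInd_complex hH hli
  have hs := hC.span_eq_top_of_card_eq_finrank' (by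
    rw [Module.finrank_matrix]; simp [sq])
  have hx : X ∈ Submodule.span ℂ (Set.range F) := by rw [hs]; trivial
  obtain ⟨c, hc⟩ := (Submodule.mem_span_range_iff_exists_fun ℂ).mp hx
  exact ⟨c, hc.symm⟩

open scoped MatrixOrder Matrix.Norms.L2Operator in
lemma pw_psd_sqrt {n : Type*} [Fintype n] [DecidableEq n] {A B : Matrix n n ℝ}
    (hA : A.PosSemidef) (hB : B.PosSemidef) (h : A * A * B * B = 1) : B * A = 1 := by
  have h1 : (A * A) * (B * B) = 1 := by rw [← h]; noncomm_ring
  have h2 : (B * B) * (A * A) = 1 := mul_eq_one_comm.mp h1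
  have hBu : B * (B * A * A) = 1 := by rw [← h2]; noncomm_ring
  have hdet : IsUnit B.det := Matrix.isUnit_det_of_right_inverse hBu
  have h3 : A * A = B⁻¹ * B⁻¹ := by
    rw [← Matrix.mul_inv_rev]
    exact (Matrix.inv_eq_left_inv h1).symm
  have h4 : A = B⁻¹ :=
    (CFC.mul_self_eq_mul_self_iff A B⁻¹ hA.nonneg hB.inv.nonneg).mp h3
  rw [h4, Matrix.mul_nonsing_inv _ hdet]

/-- The matrix of a map in an orthonormal family. -/
noncomputable def pwMat {d : ℕ} (E : Fin (d ^ 2) → Matrix (Fin d) (Fin d) ℂ)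
    (G : Matrix (Fin d) (Fin d) ℂ → Matrix (Fin d) (Fin d) ℂ) :
    Matrix (Fin (d ^ 2)) (Fin (d ^ 2)) ℝ :=
  Matrix.of fun i j => ((E i * G (E j)).trace).re

lemma pwMat_psd {d : ℕ} {E : Fin (d ^ 2) → Matrix (Fin d) (Fin d) ℂ}
    {G : Matrix (Fin d) (Fin d) ℂ → Matrix (Fin d) (Fin d) ℂ}
    (hE : ∀ i, (E i).IsHermitian) (hG : IsPosSelfAdjMap G) : (pwMat E G).PosSemidef := by
  obtain ⟨hlin, hh, hsa, hpos⟩ := hG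
  refine Matrix.PosSemidef.of_dotProduct_mulVec_nonneg ?_ ?_
  · ext i j
    simp only [pwMat, Matrix.conjTranspose_apply, Matrix.of_apply, star_trivial]
    rw [← hsa _ _ (hE j) (hE i), Matrix.trace_mul_comm]
  · intro x
    have hX : (∑ i, x i • E i).IsHermitian := by
      unfold Matrix.IsHermitian
      simp [Matrix.conjTranspose_sum, Matrix.conjTranspose_smul, (hE _).eq]
    have := hpos _ hX
    have hGX : G (∑ i, x i • E i) = ∑ i, x i • G (E i) := by
      have := map_sum (hlin.mk' G) (fun i => x i • E i) Finset.univ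
      simpa only [IsLinearMap.mk'_apply, hlin.map_smul] using this
    rw [hGX] at this
    refine this.trans_eq ?_
    symm
    simp [dotProduct, Matrix.mulVec, pwMat, Finset.sum_mul, Finset.mul_sum, Matrix.trace_sum,
      Complex.re_sum]
    rw [Finset.sum_comm]
    refine Finset.sum_congr rfl fun i _ => Finset.sum_congr rfl fun j _ => ?_
    ring

lemma pwMat_apply {d : ℕ} {E : Fin (d ^ 2) → Matrix (Fin d) (Fin d) ℂ}
    {G : Matrix (Fin d) (Fin d) ℂ → Matrix (Fin d) (Fin d) ℂ}
    (hE : ∀ i, (E i).IsHermitian) (hG : IsPosSelfAdjMap G)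
    (hex : ∀ X : Matrix (Fin d) (Fin d) ℂ, X.IsHermitian → X = ∑ i, ((E i * X).trace).re • E i)
    {X : Matrix (Fin d) (Fin d) ℂ} (c : Fin (d ^ 2) → ℝ)
    (hX : X = ∑ i, c i • E i) : G X = ∑ i, ((pwMat E G) *ᵥ c) i • E i := by
  obtain ⟨hlin, hh, hsa, hpos⟩ := hG
  have hGX : G X = ∑ i, c i • G (E i) := by
    have := map_sum (hlin.mk' G) (fun i => c i • E i) Finset.univ
    rw [hX]
    simpa only [IsLinearMap.mk'_apply, hlin.map_smul] using this
  have h2 : G X = ∑ j, c j • ∑ i, ((E i * G (E j)).trace).re • E i := by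
    rw [hGX]
    refine Finset.sum_congr rfl fun j _ => ?_
    rw [← hex _ (hh _ (hE j))]
  rw [h2]
  simp only [Matrix.mulVec, dotProduct, pwMat, Finset.smul_sum, Finset.sum_smul, Matrix.of_apply]
  rw [Finset.sum_comm]
  refine Finset.sum_congr rfl fun i _ => Finset.sum_congr rfl fun j _ => ?_
  rw [smul_smul, mul_comm]

/-- if `R` is the positive self-adjoint square root of the rescaled frame
operator `S_L` of a measure basis `L`, and `F` is a Wigner basis, then `Mᵢ := R(Fᵢ)` is a
measure basis with the same weights as `F`, its rescaled frame operator equals `S_L`, and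
its principal Wigner basis is `F`. -/
theorem measure_basis_behind_wigner {d : ℕ} [NeZero d]
    (F : Fin (d ^ 2) → Matrix (Fin d) (Fin d) ℂ)
    (hF : IsWignerBasis F) (hFpos : ∀ i, 0 < ((F i).trace).re)
    (L : Fin (d ^ 2) → Matrix (Fin d) (Fin d) ℂ)
    (hL : IsMeasureBasis L) (hLpos : ∀ i, 0 < ((L i).trace).re)
    (R : Matrix (Fin d) (Fin d) ℂ → Matrix (Fin d) (Fin d) ℂ)
    (hR : IsPosSelfAdjMap R)
    (hRsq : ∀ X : Matrix (Fin d) (Fin d) ℂ, X.IsHermitian → R (R X) = rsFrameOp L X)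
    (M : Fin (d ^ 2) → Matrix (Fin d) (Fin d) ℂ) (hM : ∀ i, M i = R (F i))
    (T : Matrix (Fin d) (Fin d) ℂ → Matrix (Fin d) (Fin d) ℂ)
    (hT : IsInvSqrtOfFrameOp M T) :
    IsMeasureBasis M ∧
    (∀ i, (M i).trace = (F i).trace) ∧
    (∀ X : Matrix (Fin d) (Fin d) ℂ, X.IsHermitian → rsFrameOp M X = rsFrameOp L X) ∧
    (∀ i, T (M i) = F i) := by
  obtain ⟨⟨hFH, hFli, hFsum, hFnn⟩, hFo⟩ := hF
  have hRcopy := hR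
  obtain ⟨hRlin, hRh, hRsa, hRpos⟩ := hRcopy
  have hTcopy := hT.1
  obtain ⟨hTlin, hTh, hTsa, hTpos⟩ := hTcopy
  -- the unit is fixed
  have h1H : (1 : Matrix (Fin d) (Fin d) ℂ).IsHermitian := Matrix.isHermitian_one
  have hLt : ∀ j, (L j).trace ≠ 0 := fun j h => by
    have := hLpos j
    simp [h] at this
  have hRR1 : R (R 1) = 1 := by
    rw [hRsq _ h1H, rsFrameOp]
    simp only [one_mul]
    rw [← hL.2.2.1]
    refine Finset.sum_congr rfl fun j _ => ?_
    rw [div_self (hLt j), one_smul]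
  have hR1 : R 1 = 1 := by
    set Y := R 1 - 1 with hY
    have hYH : Y.IsHermitian := (hRh _ h1H).sub h1H
    have hRY : R Y = -Y := by
      rw [hY, hRlin.map_sub, hRR1, neg_sub]
    have h := hRpos Y hYH
    rw [hRY, Matrix.mul_neg, Matrix.trace_neg, Complex.neg_re] at h
    have h0 : 0 ≤ (Yᴴ * Y).trace := (Matrix.posSemidef_conjTranspose_mul_self Y).trace_nonneg
    rw [hYH.eq] at h0
    have h00 : (Y * Y).trace = 0 := by
      rw [pw_real_trace hYH hYH] at h0 ⊢
      have : 0 ≤ ((Y * Y).trace).re := by exact_mod_cast h0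
      have : ((Y * Y).trace).re = 0 := by linarith
      rw [this]; simp
    have : Y = 0 := Matrix.trace_conjTranspose_mul_self_eq_zero_iff.mp (by rw [hYH.eq]; exact h00)
    exact sub_eq_zero.mp this
  have hMt : ∀ i, (M i).trace = (F i).trace := fun i => by
    have := hRsa (F i) 1 (hFH i) h1H
    rw [hR1, mul_one, mul_one] at this
    rw [hM, this]
  have hMH : ∀ i, (M i).IsHermitian := fun i => by rw [hM]; exact hRh _ (hFH i)
  have hMsum : ∑ i, M i = 1 := by
    have := map_sum (hRlin.mk' R) F Finset.univ
    simp only [IsLinearMap.mk'_apply, hFsum, hR1] at this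
    simp only [hM]; exact this.symm
  -- expansion in the Wigner basis
  have hFF : ∀ i, (F i * F i).trace = (F i).trace := fun i => by
    have : (F i * ∑ j, F j).trace = (F i * F i).trace := by
      rw [Finset.mul_sum, Matrix.trace_sum]
      exact Finset.sum_eq_single i (fun j _ hj => hFo i j hj.symm) (by simp)
    rw [← this, hFsum, mul_one]
  have hFt : ∀ i, (F i).trace = (((F i).trace).re : ℂ) := fun i => by
    have := pw_real_trace (hFH i) (hFH i)
    rwa [hFF] at this
  have hFt0 : ∀ j, (F j).trace ≠ 0 := fun j h => by
    have := hFpos j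
    simp [h] at this
  have hSF : ∀ X : Matrix (Fin d) (Fin d) ℂ, rsFrameOp F X = X := fun X => by
    obtain ⟨c, hc⟩ := pw_expand hFH hFli X
    rw [rsFrameOp]
    conv_rhs => rw [hc]
    refine Finset.sum_congr rfl fun j _ => ?_
    congr 1
    rw [hc, Finset.sum_mul, Matrix.trace_sum, Finset.sum_eq_single j]
    · rw [Matrix.smul_mul, Matrix.trace_smul, hFF, smul_eq_mul, mul_div_cancel_right₀ _ (hFt0 j)]
    · intro i _ hij
      rw [Matrix.smul_mul, Matrix.trace_smul, hFo i j hij, smul_zero]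
    · simp
  have hexF : ∀ X : Matrix (Fin d) (Fin d) ℂ, X.IsHermitian →
      X = ∑ i, (((X * F i).trace).re / ((F i).trace).re) • F i := fun X hX => by
    conv_lhs => rw [← hSF X, rsFrameOp]
    refine Finset.sum_congr rfl fun j _ => ?_
    rw [pw_real_trace hX (hFH j), hFt j, ← Complex.ofReal_div, Complex.coe_smul]
    simp
  have hSM : ∀ X : Matrix (Fin d) (Fin d) ℂ, X.IsHermitian → rsFrameOp M X = R (R X) := by
    intro X hX
    have h := hexF (R X) (hRh _ hX)
    have h2 := map_sum (hRlin.mk' R)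
      (fun i => (((R X * F i).trace).re / ((F i).trace).re) • F i) Finset.univ
    rw [← h] at h2
    simp only [IsLinearMap.mk'_apply, hRlin.map_smul] at h2
    rw [h2, rsFrameOp]
    refine Finset.sum_congr rfl fun j _ => ?_
    rw [hMt, hM, ← hRsa X (F j) hX (hFH j), pw_real_trace (hRh _ hX) (hFH j), hFt j,
      ← Complex.ofReal_div, Complex.coe_smul]
    simp
  -- orthonormalisation
  let E : Fin (d ^ 2) → Matrix (Fin d) (Fin d) ℂ := fun i => (√((F i).trace.re))⁻¹ • F i
  have hEH : ∀ i, (E i).IsHermitian := fun i => by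
    simp [E, Matrix.IsHermitian, Matrix.conjTranspose_smul, (hFH i).eq]
  have hexE : ∀ X : Matrix (Fin d) (Fin d) ℂ, X.IsHermitian →
      X = ∑ i, ((E i * X).trace).re • E i := fun X hX => by
    conv_lhs => rw [hexF X hX]
    refine Finset.sum_congr rfl fun j _ => ?_
    have hs : √((F j).trace.re) * √((F j).trace.re) = (F j).trace.re :=
      Real.mul_self_sqrt (hFpos j).le
    simp only [E, Matrix.smul_mul, Matrix.trace_smul, Complex.smul_re, smul_smul]
    congr 1
    rw [Matrix.trace_mul_comm, smul_eq_mul, div_eq_mul_inv]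
    have hi : ((F j).trace.re)⁻¹ = (√((F j).trace.re))⁻¹ * (√((F j).trace.re))⁻¹ := by
      rw [← mul_inv, hs]
    rw [hi]
    ring
  have hEF : ∀ i, F i = √((F i).trace.re) • E i := fun i => by
    simp only [E, smul_smul]
    rw [mul_inv_cancel₀ (Real.sqrt_pos.mpr (hFpos i)).ne', one_smul]
  have hEli : LinearIndependent ℝ E := by
    have := hFli.units_smul (fun i => Units.mk0 ((√((F i).trace.re))⁻¹)
      (inv_ne_zero (Real.sqrt_pos.mpr (hFpos i)).ne'))
    exact this
  have hMat : pwMat E R * pwMat E R * pwMat E T * pwMat E T = 1 := by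
    ext i j
    have hj : E j = ∑ k, (Pi.single j (1 : ℝ) : Fin (d ^ 2) → ℝ) k • E k := by
      rw [Finset.sum_eq_single j] <;> simp +contextual
    have e1 := pwMat_apply hEH hT.1 hexE _ hj
    have e2 := pwMat_apply hEH hT.1 hexE _ e1
    have e3 := pwMat_apply hEH hR hexE _ e2
    have e4 := pwMat_apply hEH hR hexE _ e3
    rw [← hSM _ (hTh _ (hTh _ (hEH j))), hT.2 _ (hEH j)] at e4
    have e5 := hj.symm.trans e4
    have := congrFun (hEli.fintypeLinearCombination_injective
      (a₁ := Pi.single j 1) (by simpa only [Fintype.linearCombination_apply] using e5)) i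
    simp only [Matrix.mulVec_mulVec] at this
    rw [Matrix.mulVec_single_one] at this
    simp only [← mul_assoc, Matrix.col_apply] at this
    rw [← this, Matrix.one_apply, Pi.single_apply]
  have hBA := pw_psd_sqrt (pwMat_psd hEH hR) (pwMat_psd hEH hT.1) hMat
  have hTM : ∀ i, T (M i) = F i := by
    intro i
    have hj : F i = ∑ k, (Pi.single i (√((F i).trace.re)) : Fin (d ^ 2) → ℝ) k • E k := by
      rw [Finset.sum_eq_single i]
      · rw [Pi.single_eq_same]; exact hEF i
      · intro k _ hk; simp [hk]
      · simp
    have e1 := pwMat_apply hEH hR hexE _ hj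
    have e2 := pwMat_apply hEH hT.1 hexE _ e1
    rw [Matrix.mulVec_mulVec, hBA, Matrix.one_mulVec, ← hj] at e2
    rw [hM, e2]
  refine ⟨⟨hMH, ?_, hMsum, fun i => by rw [hMt]; exact hFnn i⟩, hMt,
    fun X hX => by rw [hSM X hX, hRsq X hX], hTM⟩
  refine LinearIndependent.of_comp (hTlin.mk' T) ?_
  have : (hTlin.mk' T) ∘ M = F := funext hTM
  rw [this]; exact hFli
end

section
/- Let d ≥ 1, let E = {E_i}_{i=1}^{d²} be an unbiased MIC (tr E_i = 1/d for all i) for d×d complex matrices with Gram matrix G, and let F = {F_i}_{i=1}^{d²} be an unbiased Wigner basis. Let λ_1,…,λ_{d²} be the eigenvalues of G and let ‖X‖² = tr(X²) denote the squared Hilbert–Schmidt norm of a Hermitian matrix X. Then Σ_k (√λ_k − √(1/d))² ≤ Σ_i ‖E_i − F_i‖² ≤ Σ_k (√λ_k + √(1/d))² − 4/d, where the lower bound is attained if and only if F = PW(E), and the upper bound is attained if and only if F = SPW(E). -/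
open Matrix BigOperators
open scoped ComplexOrder Kronecker

section helpers

open scoped MatrixOrder in
lemma trace_of_psd_sq {n : Type*} [Fintype n] [DecidableEq n] {A G : Matrix n n ℝ}
    (hA : A.PosSemidef) (hAG : A * A = G) (hG : G.IsHermitian) :
    A.trace = ∑ k, Real.sqrt (hG.eigenvalues k) := by
  have h1 : CFC.sqrt G = A := CFC.sqrt_unique hAG hA.nonneg
  have hGp : G.PosSemidef := by
    rw [← hAG]
    have := Matrix.posSemidef_conjTranspose_mul_self A
    rwa [hA.1.eq] at this
  have hGn : 0 ≤ G := hGp.nonneg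
  rw [← h1, CFC.sqrt_eq_cfc, cfc_nnreal_eq_real _ G, hG.cfc_eq, Matrix.IsHermitian.cfc,
    Unitary.conjStarAlgAut_apply, Matrix.trace_mul_comm, ← mul_assoc, Unitary.coe_star_mul_self,
    one_mul, Matrix.trace_diagonal]
  refine Finset.sum_congr rfl fun k _ => ?_
  simp only [Function.comp_apply, Real.sqrt]
  rfl

lemma trace_mul_orth_le {n : Type*} [Fintype n] [DecidableEq n] {M O : Matrix n n ℝ}
    (hM : M.PosSemidef) (hinj : ∀ c, M *ᵥ c = 0 → c = 0) (hO : Oᵀ * O = 1) :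
    (M * O).trace ≤ M.trace ∧ ((M * O).trace = M.trace → O = 1) := by
  have hO' : O * Oᵀ = 1 := mul_eq_one_comm.mp hO
  have hMt : Mᵀ = M := by simpa using hM.1.eq
  have key : ((O - 1)ᵀ * M * (O - 1)).trace = 2 * (M.trace - (M * O).trace) := by
    have e1 : (Oᵀ * M * O).trace = M.trace := by
      rw [Matrix.trace_mul_comm, ← mul_assoc, hO', one_mul]
    have e2 : (Oᵀ * M).trace = (M * O).trace := by
      rw [← Matrix.trace_transpose (M * O), Matrix.transpose_mul, hMt]
    simp only [Matrix.transpose_sub, Matrix.transpose_one, sub_mul, mul_sub, one_mul, mul_one,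
      Matrix.trace_sub, e1, e2]
    ring
  have hp : ∀ j, 0 ≤ ((O - 1)ᵀ * M * (O - 1) : Matrix n n ℝ) j j := by
    intro j
    have h := hM.conjTranspose_mul_mul_same (O - 1)
    rw [Matrix.conjTranspose_eq_transpose_of_trivial] at h
    exact h.diag_nonneg
  have hdiag : ∀ j, ((O - 1)ᵀ * M * (O - 1) : Matrix n n ℝ) j j
      = star ((O - 1)ᵀ j) ⬝ᵥ (M *ᵥ ((O - 1)ᵀ j)) := by
    intro j
    rw [mul_assoc, Matrix.mul_apply]
    simp only [dotProduct, star_trivial]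
    rfl
  constructor
  · have : 0 ≤ ((O - 1)ᵀ * M * (O - 1)).trace := Finset.sum_nonneg fun j _ => hp j
    linarith
  · intro h
    rw [h, sub_self, mul_zero] at key
    have hz := (Finset.sum_eq_zero_iff_of_nonneg (fun j _ => hp j)).mp key
    have hc : (O - 1)ᵀ = 0 := by
      funext j
      have := hz j (Finset.mem_univ j)
      rw [hdiag, hM.dotProduct_mulVec_zero_iff] at this
      exact hinj _ this
    have := Matrix.transpose_eq_zero.mp hc
    exact sub_eq_zero.mp this

/-- The real bilinear form `re tr (X Y)`. -/
noncomputable def ipr (d : ℕ) : Matrix (Fin d) (Fin d) ℂ →ₗ[ℝ] Matrix (Fin d) (Fin d) ℂ →ₗ[ℝ] ℝ :=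
  LinearMap.mk₂ ℝ (fun X Y => ((X * Y).trace).re)
    (by intros; simp [add_mul]) (by intros; simp)
    (by intros; simp [mul_add]) (by intros; simp)

lemma ipr_apply {d : ℕ} (X Y : Matrix (Fin d) (Fin d) ℂ) : ipr d X Y = ((X * Y).trace).re := rfl

lemma ipr_comm {d : ℕ} (X Y : Matrix (Fin d) (Fin d) ℂ) : ipr d X Y = ipr d Y X := by
  rw [ipr_apply, ipr_apply, Matrix.trace_mul_comm]

lemma ipr_coe {d : ℕ} {X Y : Matrix (Fin d) (Fin d) ℂ} (hX : X.IsHermitian) (hY : Y.IsHermitian) :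
    (X * Y).trace = ((ipr d X Y : ℝ) : ℂ) := by
  have : star (X * Y).trace = (X * Y).trace := by
    rw [← Matrix.trace_conjTranspose, Matrix.conjTranspose_mul, hX.eq, hY.eq,
      Matrix.trace_mul_comm]
  exact (Complex.conj_eq_iff_re.mp this).symm

lemma herm_sum {d : ℕ} {ι : Type*} [Fintype ι] (c : ι → ℝ) {X : ι → Matrix (Fin d) (Fin d) ℂ}
    (hX : ∀ i, (X i).IsHermitian) : (∑ i, c i • X i).IsHermitian := by
  unfold Matrix.IsHermitian
  rw [Matrix.conjTranspose_sum]
  refine Finset.sum_congr rfl fun i _ => ?_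
  rw [Matrix.conjTranspose_smul, (hX i).eq, star_trivial]

/-- Core inequality. -/
lemma core {d : ℕ} [NeZero d]
    (E : Fin (d ^ 2) → Matrix (Fin d) (Fin d) ℂ)
    (hEh : ∀ i, (E i).IsHermitian) (hEl : LinearIndependent ℝ E)
    (hEunb : ∀ i, (E i).trace = ((d : ℂ))⁻¹)
    (G : Matrix (Fin (d ^ 2)) (Fin (d ^ 2)) ℝ)
    (hG : ∀ i j, G i j = ipr d (E i) (E j))
    (hGh : G.IsHermitian)
    (T : Matrix (Fin d) (Fin d) ℂ → Matrix (Fin d) (Fin d) ℂ)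
    (hT : IsInvSqrtOfFrameOp E T) :
    (∀ i j, ipr d (T (E i)) (T (E j)) = if i = j then (d : ℝ)⁻¹ else 0) ∧
    (∀ i, (T (E i)).IsHermitian) ∧
    (∑ i, ipr d (E i) (T (E i)) = √((d : ℝ)⁻¹) * ∑ k, √(hGh.eigenvalues k)) ∧
    ∀ F : Fin (d ^ 2) → Matrix (Fin d) (Fin d) ℂ, (∀ i, (F i).IsHermitian) →
      (∀ i j, ipr d (F i) (F j) = if i = j then (d : ℝ)⁻¹ else 0) →
      (∑ i, ipr d (E i) (F i) ≤ √((d : ℝ)⁻¹) * ∑ k, √(hGh.eigenvalues k)) ∧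
      (∑ i, ipr d (E i) (F i) = √((d : ℝ)⁻¹) * ∑ k, √(hGh.eigenvalues k) ↔ ∀ i, F i = T (E i)) := by
  obtain ⟨⟨hTl, hTh, hTs, hTp⟩, hTS⟩ := hT
  have hd : (d : ℝ) ≠ 0 := Nat.cast_ne_zero.mpr (NeZero.ne d)
  have hdpos : (0 : ℝ) < d := lt_of_le_of_ne (Nat.cast_nonneg d) hd.symm
  obtain ⟨TL, hTL⟩ : ∃ TL : Matrix (Fin d) (Fin d) ℂ →ₗ[ℝ] Matrix (Fin d) (Fin d) ℂ,
      ∀ X, T X = TL X := ⟨hTl.mk' T, fun _ => rfl⟩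
  have hs : ∀ X Y, X.IsHermitian → Y.IsHermitian → ipr d (TL X) Y = ipr d X (TL Y) := by
    intro X Y hX hY
    simp only [ipr_apply, ← hTL, hTs X Y hX hY]
  have hTh' : ∀ X, X.IsHermitian → (TL X).IsHermitian := by simpa only [hTL] using hTh
  have hTS' : ∀ X, X.IsHermitian → ∑ j, (d * ipr d (TL (TL X)) (E j)) • E j = X := by
    intro X hX
    conv_rhs => rw [← hTS X hX]
    unfold rsFrameOp
    refine Finset.sum_congr rfl fun j _ => ?_
    rw [hTL, hTL, ipr_coe (hTh' _ (hTh' _ hX)) (hEh j), hEunb, div_inv_eq_mul,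
      ← Complex.coe_smul]
    congr 1
    push_cast; ring
  have hEE : ∀ i j, ipr d (TL (TL (E i))) (E j) = if i = j then (d : ℝ)⁻¹ else 0 := by
    intro i j
    have h1 := hTS' (E i) (hEh i)
    have h2 : ∑ k, ((d * ipr d (TL (TL (E i))) (E k)) - if i = k then 1 else 0) • E k = 0 := by
      simp only [sub_smul, Finset.sum_sub_distrib, h1]
      simp
    have h3 := Fintype.linearIndependent_iff.mp hEl _ h2 j
    split_ifs at h3 ⊢ with h
    · field_simp; linarith
    · simpa [hd] using h3
  have hWh : ∀ i, (TL (E i)).IsHermitian := fun i => hTh' _ (hEh i)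
  have hW : ∀ i j, ipr d (TL (E i)) (TL (E j)) = if i = j then (d : ℝ)⁻¹ else 0 := by
    intro i j
    rw [← hs _ _ (hWh i) (hEh j), hEE]
  have hsurj : ∀ X, X.IsHermitian → ∃ Y, Y.IsHermitian ∧ TL Y = X := by
    let V := selfAdjoint.submodule ℝ (Matrix (Fin d) (Fin d) ℂ)
    have hmem : ∀ X, X ∈ V ↔ X.IsHermitian := fun X => Iff.rfl
    let R : V →ₗ[ℝ] V := TL.restrict (fun X hX => hTh' X hX)
    have hinj : Function.Injective R := by
      rw [injective_iff_map_eq_zero]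
      rintro ⟨X, hX⟩ h
      have h' : TL X = 0 := congrArg Subtype.val h
      have := hTS' X hX
      rw [h'] at this
      ext1
      simpa using this.symm
    have hsu := LinearMap.injective_iff_surjective.mp hinj
    intro X hX
    obtain ⟨⟨Y, hY⟩, h⟩ := hsu ⟨X, hX⟩
    exact ⟨Y, hY, congrArg Subtype.val h⟩
  have hexp : ∀ X, X.IsHermitian → X = ∑ j, (d * ipr d X (TL (E j))) • TL (E j) := by
    intro X hX
    obtain ⟨Y, hY, rfl⟩ := hsurj X hX
    conv_lhs => rw [← hTS' Y hY]
    rw [map_sum]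
    refine Finset.sum_congr rfl fun j _ => ?_
    rw [map_smul, hs _ _ (hTh' Y hY) (hEh j)]
  have hpars : ∀ X Y, X.IsHermitian →
      ipr d X Y = d * ∑ j, ipr d X (TL (E j)) * ipr d Y (TL (E j)) := by
    intro X Y hX
    conv_lhs => rw [hexp X hX]
    rw [map_sum, LinearMap.sum_apply, Finset.mul_sum]
    refine Finset.sum_congr rfl fun j _ => ?_
    rw [map_smul, LinearMap.smul_apply, smul_eq_mul, ipr_comm Y, mul_assoc]
  let M : Matrix (Fin (d ^ 2)) (Fin (d ^ 2)) ℝ := Matrix.of fun i j => ipr d (E i) (TL (E j))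
  have hMa : ∀ i j, M i j = ipr d (E i) (TL (E j)) := fun _ _ => rfl
  have hMsym : ∀ i j, M i j = M j i := by
    intro i j
    rw [hMa, hMa, ← hs _ _ (hEh i) (hEh j), ipr_comm]
  have hMv : ∀ c i, (M *ᵥ c) i = ipr d (E i) (TL (∑ k, c k • E k)) := by
    intro c i
    simp only [Matrix.mulVec, dotProduct, hMa, map_sum, map_smul, smul_eq_mul, mul_comm]
  have hMpsd : M.PosSemidef := by
    refine .of_dotProduct_mulVec_nonneg ?_ ?_
    · ext i j
      simp only [Matrix.conjTranspose_apply, star_trivial]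
      exact hMsym j i
    · intro c
      have : star c ⬝ᵥ M *ᵥ c = ipr d (∑ k, c k • E k) (TL (∑ k, c k • E k)) := by
        simp only [dotProduct, hMv, star_trivial]
        generalize TL (∑ k, c k • E k) = Z
        simp only [map_sum, map_smul, LinearMap.sum_apply, LinearMap.smul_apply, smul_eq_mul]
      rw [this, ipr_apply, ← hTL]
      exact hTp _ (herm_sum c hEh)
  have hMinj : ∀ c, M *ᵥ c = 0 → c = 0 := by
    intro c hc
    have hh := herm_sum c hEh
    have h1 : ∀ i, ipr d (∑ k, c k • E k) (TL (E i)) = 0 := by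
      intro i
      rw [← hs _ _ hh (hEh i), ipr_comm, ← hMv, hc]; rfl
    have h2 := hexp _ hh
    simp only [h1, mul_zero, zero_smul, Finset.sum_const_zero] at h2
    funext k
    exact Fintype.linearIndependent_iff.mp hEl _ h2 k
  have hMM : (√(d : ℝ) • M) * (√(d : ℝ) • M) = G := by
    ext i j
    rw [smul_mul_smul_comm, Real.mul_self_sqrt hdpos.le, Matrix.smul_apply, Matrix.mul_apply, hG,
      hpars _ _ (hEh i), smul_eq_mul]
    congr 1
    refine Finset.sum_congr rfl fun k _ => ?_
    rw [hMsym k j, hMa, hMa]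
  have hMtr : M.trace = √((d : ℝ)⁻¹) * ∑ k, √(hGh.eigenvalues k) := by
    rw [← trace_of_psd_sq (hMpsd.smul (Real.sqrt_nonneg (d : ℝ))) hMM hGh, Matrix.trace_smul,
      smul_eq_mul, ← mul_assoc, Real.sqrt_inv, inv_mul_cancel₀ (Real.sqrt_pos.mpr hdpos).ne',
      one_mul]
  have hWtr : ∑ i, ipr d (E i) (TL (E i)) = M.trace := rfl
  simp only [hTL]
  refine ⟨hW, hWh, by rw [hWtr, hMtr], ?_⟩
  intro F hFh hF
  let O : Matrix (Fin (d ^ 2)) (Fin (d ^ 2)) ℝ := Matrix.of fun k j => d * ipr d (F j) (TL (E k))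
  have hOa : ∀ k j, O k j = d * ipr d (F j) (TL (E k)) := fun _ _ => rfl
  have hOO : Oᵀ * O = 1 := by
    ext i j
    have h1 := hpars (F i) (F j) (hFh i)
    rw [hF] at h1
    have : (Oᵀ * O) i j = d * (d * ∑ k, ipr d (F i) (TL (E k)) * ipr d (F j) (TL (E k))) := by
      rw [Matrix.mul_apply]
      simp only [Matrix.transpose_apply, hOa, Finset.mul_sum]
      refine Finset.sum_congr rfl fun k _ => ?_
      ring
    rw [this, ← h1, Matrix.one_apply]
    split_ifs <;> simp [hd]
  have hMO : ∑ i, ipr d (E i) (F i) = (M * O).trace := by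
    refine Finset.sum_congr rfl fun i _ => ?_
    rw [Matrix.diag_apply, Matrix.mul_apply, hpars _ _ (hEh i), Finset.mul_sum]
    refine Finset.sum_congr rfl fun k _ => ?_
    rw [hMa, hOa]; ring
  obtain ⟨hle, heq⟩ := trace_mul_orth_le hMpsd hMinj hOO
  rw [← hMtr, hMO]
  refine ⟨hle, fun h j => ?_, fun h => ?_⟩
  · have hO1 := heq h
    rw [hexp (F j) (hFh j)]
    have : ∀ k, d * ipr d (F j) (TL (E k)) = if k = j then 1 else 0 := by
      intro k
      rw [← hOa, hO1, Matrix.one_apply]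
    simp [this]
  · rw [← hMO, ← hWtr]
    exact Finset.sum_congr rfl fun i _ => by rw [h i]

end helpers

/-- for an unbiased MIC `E` (Gram eigenvalues `λₖ`) and unbiased Wigner
basis `F`, `∑ₖ(√λₖ − √(1/d))² ≤ ∑ᵢ‖Eᵢ − Fᵢ‖² ≤ ∑ₖ(√λₖ + √(1/d))² − 4/d`, with the lower
bound attained iff `F = PW(E)` and the upper bound attained iff `F = SPW(E)`. -/
theorem distance_mic_wigner_bounds {d : ℕ} [NeZero d]
    (E : Fin (d ^ 2) → Matrix (Fin d) (Fin d) ℂ)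
    (hE : IsMeasureBasis E) (hEpsd : ∀ i, (E i).PosSemidef)
    (hEunb : ∀ i, (E i).trace = ((d : ℂ))⁻¹)
    (F : Fin (d ^ 2) → Matrix (Fin d) (Fin d) ℂ)
    (hF : IsWignerBasis F) (hFunb : ∀ i, (F i).trace = ((d : ℂ))⁻¹)
    (G : Matrix (Fin (d ^ 2)) (Fin (d ^ 2)) ℝ)
    (hG : ∀ i j, G i j = ((E i * E j).trace).re)
    (hGh : G.IsHermitian)
    (T : Matrix (Fin d) (Fin d) ℂ → Matrix (Fin d) (Fin d) ℂ)
    (hT : IsInvSqrtOfFrameOp E T) :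
    (∑ k, (Real.sqrt (hGh.eigenvalues k) - Real.sqrt ((d : ℝ)⁻¹)) ^ 2 ≤
        ∑ i, (((E i - F i) * (E i - F i)).trace).re) ∧
    (∑ i, (((E i - F i) * (E i - F i)).trace).re ≤
        (∑ k, (Real.sqrt (hGh.eigenvalues k) + Real.sqrt ((d : ℝ)⁻¹)) ^ 2) - 4 / (d : ℝ)) ∧
    ((∑ i, (((E i - F i) * (E i - F i)).trace).re =
        ∑ k, (Real.sqrt (hGh.eigenvalues k) - Real.sqrt ((d : ℝ)⁻¹)) ^ 2) ↔
      ∀ i, F i = T (E i)) ∧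
    ((∑ i, (((E i - F i) * (E i - F i)).trace).re =
        (∑ k, (Real.sqrt (hGh.eigenvalues k) + Real.sqrt ((d : ℝ)⁻¹)) ^ 2) - 4 / (d : ℝ)) ↔
      ∀ i, F i = -(T (E i)) +
        ((2 * ((E i).trace).re / (d : ℝ)) • (1 : Matrix (Fin d) (Fin d) ℂ))) := by
  have hd : (d : ℝ) ≠ 0 := Nat.cast_ne_zero.mpr (NeZero.ne d)
  have hdpos : (0 : ℝ) < d := lt_of_le_of_ne (Nat.cast_nonneg d) hd.symm
  obtain ⟨hEh, hEl, hE1, -⟩ := hE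
  obtain ⟨⟨hFh, hFl, hF1, -⟩, hFo⟩ := hF
  have htr : ∀ X : Matrix (Fin d) (Fin d) ℂ, ipr d X 1 = X.trace.re := by
    intro X; rw [ipr_apply, mul_one]
  have hdre : (((d : ℂ))⁻¹).re = (d : ℝ)⁻¹ := by
    rw [← Complex.ofReal_natCast, ← Complex.ofReal_inv, Complex.ofReal_re]
  have hEt : ∀ i, ipr d (E i) 1 = (d : ℝ)⁻¹ := fun i => by rw [htr, hEunb, hdre]
  have hFt : ∀ i, ipr d (F i) 1 = (d : ℝ)⁻¹ := fun i => by rw [htr, hFunb, hdre]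
  have h11 : ipr d 1 1 = (d : ℝ) := by rw [htr]; simp
  have hFF : ∀ i j, ipr d (F i) (F j) = if i = j then (d : ℝ)⁻¹ else 0 := by
    have ho : ∀ i j, i ≠ j → ipr d (F i) (F j) = 0 := fun i j h => by
      rw [ipr_apply, hFo i j h]; rfl
    intro i j
    split_ifs with h
    · subst h
      rw [← hFt i, ← hF1, map_sum]
      exact (Finset.sum_eq_single i (fun k _ hk => ho i k hk.symm) (by simp)).symm
    · exact ho i j h
  obtain ⟨-, -, -, hcore⟩ := core E hEh hEl hEunb G (fun i j => by rw [hG, ipr_apply]) hGh T hT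
  set Sg := ∑ k, √(hGh.eigenvalues k) with hSg
  set s := √((d : ℝ)⁻¹) with hsdef
  have hss : s ^ 2 = (d : ℝ)⁻¹ := Real.sq_sqrt (inv_nonneg.mpr hdpos.le)
  obtain ⟨hle1, heq1⟩ := hcore F hFh hFF
  let Fp : Fin (d ^ 2) → Matrix (Fin d) (Fin d) ℂ := fun i => -F i + (2 / (d : ℝ) ^ 2) • 1
  have hFph : ∀ i, (Fp i).IsHermitian := by
    intro i
    refine Matrix.IsHermitian.add (hFh i).neg ?_
    unfold Matrix.IsHermitian
    rw [Matrix.conjTranspose_smul, Matrix.conjTranspose_one, star_trivial]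
  have hFpFp : ∀ i j, ipr d (Fp i) (Fp j) = if i = j then (d : ℝ)⁻¹ else 0 := by
    intro i j
    rw [← hFF i j]
    simp only [Fp, map_add, map_neg, map_smul, LinearMap.add_apply, LinearMap.neg_apply,
      LinearMap.smul_apply, smul_eq_mul, ipr_comm 1 (F j), hFt, h11]
    field_simp
    ring
  obtain ⟨hle2, heq2⟩ := hcore Fp hFph hFpFp
  have hEFp : ∑ i, ipr d (E i) (Fp i) = 2 / d - ∑ i, ipr d (E i) (F i) := by
    simp only [Fp, map_add, map_neg, map_smul, smul_eq_mul, hEt, Finset.sum_add_distrib,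
      Finset.sum_neg_distrib, Finset.sum_const, Finset.card_univ, Fintype.card_fin, nsmul_eq_mul]
    push_cast
    field_simp
    ring
  have hFiff : (∀ i, F i = -(T (E i)) +
        ((2 * ((E i).trace).re / (d : ℝ)) • (1 : Matrix (Fin d) (Fin d) ℂ))) ↔
        ∀ i, Fp i = T (E i) := by
    refine forall_congr' fun i => ?_
    have : 2 * ((E i).trace).re / (d : ℝ) = 2 / (d : ℝ) ^ 2 := by
      rw [hEunb, hdre]; field_simp
    rw [this]
    simp only [Fp]
    constructor
    · intro h; rw [h]; abel
    · intro h; rw [← h]; abel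
  have hGtr : ∑ k, hGh.eigenvalues k = ∑ i, ipr d (E i) (E i) := by
    have := hGh.trace_eq_sum_eigenvalues
    simp only [RCLike.ofReal_real_eq_id, id_eq] at this
    rw [← this]
    exact Finset.sum_congr rfl fun i _ => by rw [Matrix.diag_apply, hG, ipr_apply]
  have hGpsd : G.PosSemidef := by
    refine .of_dotProduct_mulVec_nonneg hGh fun c => ?_
    have h1 : star c ⬝ᵥ G *ᵥ c = ipr d (∑ k, c k • E k) (∑ k, c k • E k) := by
      simp only [dotProduct, Matrix.mulVec, hG, star_trivial, map_sum, map_smul,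
        LinearMap.sum_apply, LinearMap.smul_apply, smul_eq_mul, ipr_apply, Finset.mul_sum]
      rw [Finset.sum_comm]
      refine Finset.sum_congr rfl fun i _ => Finset.sum_congr rfl fun j _ => ?_
      ring
    have h2 := herm_sum c hEh
    rw [h1, ipr_apply]
    nth_rewrite 1 [← h2.eq]
    exact (Complex.le_def.mp (Matrix.posSemidef_conjTranspose_mul_self _).trace_nonneg).1
  have hsq : ∀ k, √(hGh.eigenvalues k) ^ 2 = hGh.eigenvalues k := fun k =>
    Real.sq_sqrt (hGpsd.eigenvalues_nonneg k)
  have hL : ∑ k, (√(hGh.eigenvalues k) - s) ^ 2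
      = ∑ i, ipr d (E i) (E i) + d - 2 * (s * Sg) := by
    simp only [sub_sq, hsq, hss, Finset.sum_add_distrib, Finset.sum_sub_distrib, hGtr,
      ← Finset.sum_mul, ← Finset.mul_sum, ← hSg, Finset.sum_const, Finset.card_univ,
      Fintype.card_fin, nsmul_eq_mul]
    push_cast
    field_simp
    ring
  have hU : ∑ k, (√(hGh.eigenvalues k) + s) ^ 2
      = ∑ i, ipr d (E i) (E i) + d + 2 * (s * Sg) := by
    simp only [add_sq, hsq, hss, Finset.sum_add_distrib, hGtr,
      ← Finset.sum_mul, ← Finset.mul_sum, ← hSg, Finset.sum_const, Finset.card_univ,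
      Fintype.card_fin, nsmul_eq_mul]
    push_cast
    field_simp
    ring
  have hD : ∑ i, (((E i - F i) * (E i - F i)).trace).re
      = ∑ i, ipr d (E i) (E i) + d - 2 * ∑ i, ipr d (E i) (F i) := by
    simp only [← ipr_apply, map_sub, LinearMap.sub_apply, ipr_comm (F _) (E _), hFF, if_true,
      Finset.sum_sub_distrib, Finset.sum_const, Finset.card_univ, Fintype.card_fin, nsmul_eq_mul]
    push_cast
    field_simp
    ring
  rw [hL, hU, hD, hFiff, ← heq1, ← heq2]
  rw [hEFp] at hle2 ⊢
  have h4 : (4 : ℝ) / d = 2 * (2 / d) := by ring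
  rw [h4]
  refine ⟨by linarith, by linarith, ⟨fun h => by linarith, fun h => by linarith⟩,
    ⟨fun h => by linarith, fun h => by linarith⟩⟩
end
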